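/- Let 𝔠 = (𝔠ₖ)_{1≤k≤l} be an admissible chain of i-boxes of finite length l with range [a,b], and let [a′,b′] be a finite interval with a′ ≤ a and b ≤ b′. Then 𝔠 extends to an admissible chain of length b′ − a′ + 1 with range [a′,b′]; explicitly, appending the i-boxes {a, b+m] for m = 1,…,b′−b and then the i-boxes [a−m, b′} for m = 1,…,a−a′ yields such an admissible chain. -/

import Mathlib

open Set

variable {I : Type*}

/-- Every fiber of `ι` is unbounded above and unbounded below. -/
def FibersUnbounded (ι : ℤ → I) : Prop :=
  ∀ i : I, ∀ n : ℤ, (∃ k, n < k ∧ ι k = i) ∧ (∃ k, k < n ∧ ι k = i)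

/-- `s⁺ = min {t | s < t, ι t = ι s}`. -/
noncomputable def splus (ι : ℤ → I) (s : ℤ) : ℤ := sInf {t : ℤ | s < t ∧ ι t = ι s}

/-- `s⁻ = max {t | t < s, ι t = ι s}`. -/
noncomputable def sminus (ι : ℤ → I) (s : ℤ) : ℤ := sSup {t : ℤ | t < s ∧ ι t = ι s}

/-- `s(j)⁺ = min {t | s ≤ t, ι t = j}`. -/
noncomputable def jplus (ι : ℤ → I) (s : ℤ) (j : I) : ℤ := sInf {t : ℤ | s ≤ t ∧ ι t = j}

/-- `s(j)⁻ = max {t | t ≤ s, ι t = j}`. -/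
noncomputable def jminus (ι : ℤ → I) (s : ℤ) (j : I) : ℤ := sSup {t : ℤ | t ≤ s ∧ ι t = j}

/-- `[a,b]` is an i-box: `a ≤ b` and `ι a = ι b`. -/
def IsIBox (ι : ℤ → I) (a b : ℤ) : Prop := a ≤ b ∧ ι a = ι b

/-- Two i-boxes `[a₁,b₁]` and `[a₂,b₂]` commute. -/
def BoxCommute (ι : ℤ → I) (a₁ b₁ a₂ b₂ : ℤ) : Prop :=
  (sminus ι a₁ < a₂ ∧ a₂ ≤ b₂ ∧ b₂ < splus ι b₁) ∨
  (sminus ι a₂ < a₁ ∧ a₁ ≤ b₁ ∧ b₁ < splus ι b₂)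

/-- The envelope set `𝔠̃ₖ = ⋃_{1 ≤ j ≤ k} [aⱼ,bⱼ]` of the first `k` boxes of a chain. -/
def envSet (a b : ℕ → ℤ) (k : ℕ) : Set ℤ := ⋃ j ∈ Set.Icc 1 k, Set.Icc (a j) (b j)

/-- `ãₖ`, the left endpoint of the envelope. -/
noncomputable def envA (a b : ℕ → ℤ) (k : ℕ) : ℤ := sInf (envSet a b k)

/-- `b̃ₖ`, the right endpoint of the envelope. -/
noncomputable def envB (a b : ℕ → ℤ) (k : ℕ) : ℤ := sSup (envSet a b k)

/-- A chain of i-boxes `(𝔠ₖ = [a k, b k])_{1 ≤ k ≤ l}`, `l ∈ ℤ≥1 ∪ {∞}`, is admissible if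
for every finite `k ≤ l` the envelope is an interval `[ãₖ, b̃ₖ]` with exactly `k` elements and
`𝔠ₖ = [ãₖ,b̃ₖ}` or `𝔠ₖ = {ãₖ,b̃ₖ]`. -/
def IsAdmissibleChain (ι : ℤ → I) (l : ℕ∞) (a b : ℕ → ℤ) : Prop :=
  ∀ k : ℕ, 1 ≤ k → (k : ℕ∞) ≤ l →
    IsIBox ι (a k) (b k) ∧
    envSet a b k = Set.Icc (envA a b k) (envB a b k) ∧
    envB a b k + 1 = envA a b k + (k : ℤ) ∧
    ((a k = envA a b k ∧ b k = jminus ι (envB a b k) (ι (envA a b k))) ∨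
     (a k = jplus ι (envA a b k) (ι (envB a b k)) ∧ b k = envB a b k))

/-- The range `⋃_{1 ≤ k ≤ l} 𝔠ₖ` of a chain. -/
def chainRange (l : ℕ∞) (a b : ℕ → ℤ) : Set ℤ :=
  ⋃ k ∈ {k : ℕ | 1 ≤ k ∧ (k : ℕ∞) ≤ l}, Set.Icc (a k) (b k)

/-- Left endpoints of the extension of a chain `(a, b)` of length `l` with range `[x,y]`
to range `[x′,y′]`: first append the boxes `{x, y+m]` for `m = 1, …, y′−y`, then the
boxes `[x−m, y′}` for `m = 1, …, x−x′`. -/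
noncomputable def extA (ι : ℤ → I) (l : ℕ) (a : ℕ → ℤ) (x y y' : ℤ) : ℕ → ℤ :=
  fun k =>
    if k ≤ l then a k
    else if k ≤ l + (y' - y).toNat then jplus ι x (ι (y + ((k - l : ℕ) : ℤ)))
    else x - ((k - l - (y' - y).toNat : ℕ) : ℤ)

/-- Right endpoints of the extension. -/
noncomputable def extB (ι : ℤ → I) (l : ℕ) (b : ℕ → ℤ) (x y y' : ℤ) : ℕ → ℤ :=
  fun k =>
    if k ≤ l then b k
    else if k ≤ l + (y' - y).toNat then y + ((k - l : ℕ) : ℤ)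
    else jminus ι y' (ι (x - ((k - l - (y' - y).toNat : ℕ) : ℤ)))

theorem jplus_mem {ι : ℤ → I} {s t : ℤ} (hst : s ≤ t) :
    s ≤ jplus ι s (ι t) ∧ jplus ι s (ι t) ≤ t ∧ ι (jplus ι s (ι t)) = ι t := by
  have hbdd : BddBelow {u : ℤ | s ≤ u ∧ ι u = ι t} := ⟨s, fun _ hu => hu.1⟩
  have hmem : t ∈ {u : ℤ | s ≤ u ∧ ι u = ι t} := ⟨hst, rfl⟩
  have hinf := Int.csInf_mem ⟨t, hmem⟩ hbdd
  exact ⟨hinf.1, csInf_le hbdd hmem, hinf.2⟩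

theorem jminus_mem {ι : ℤ → I} {s t : ℤ} (hts : t ≤ s) :
    jminus ι s (ι t) ≤ s ∧ t ≤ jminus ι s (ι t) ∧ ι (jminus ι s (ι t)) = ι t := by
  have hbdd : BddAbove {u : ℤ | u ≤ s ∧ ι u = ι t} := ⟨s, fun _ hu => hu.1⟩
  have hmem : t ∈ {u : ℤ | u ≤ s ∧ ι u = ι t} := ⟨hts, rfl⟩
  have hsup := Int.csSup_mem ⟨t, hmem⟩ hbdd
  exact ⟨hsup.1, le_csSup hbdd hmem, hsup.2⟩

theorem envSet_succ (a b : ℕ → ℤ) (k : ℕ) :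
    envSet a b (k + 1) = envSet a b k ∪ Set.Icc (a (k + 1)) (b (k + 1)) := by
  ext z
  simp only [envSet, Set.mem_iUnion, Set.mem_union, Set.mem_Icc, exists_prop]
  constructor
  · rintro ⟨j, ⟨h1, h2⟩, hz⟩
    rcases Nat.le_succ_iff.1 h2 with h3 | rfl
    · exact Or.inl ⟨j, ⟨h1, h3⟩, hz⟩
    · exact Or.inr hz
  · rintro (⟨j, ⟨h1, h2⟩, hz⟩ | hz)
    · exact ⟨j, ⟨h1, by omega⟩, hz⟩
    · exact ⟨k + 1, ⟨by omega, le_rfl⟩, hz⟩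

theorem envSet_congr {a b a' b' : ℕ → ℤ} {k : ℕ}
    (ha : ∀ j ≤ k, a' j = a j) (hb : ∀ j ≤ k, b' j = b j) :
    envSet a' b' k = envSet a b k := by
  unfold envSet
  refine Set.iUnion₂_congr fun j hj => ?_
  rw [ha j hj.2, hb j hj.2]

theorem chainRange_natCast (n : ℕ) (a b : ℕ → ℤ) : chainRange (n : ℕ∞) a b = envSet a b n := by
  simp [chainRange, envSet]

theorem envA_eq {a b : ℕ → ℤ} {k : ℕ} {u v : ℤ} (huv : u ≤ v)
    (he : envSet a b k = Set.Icc u v) : envA a b k = u := by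
  rw [envA, he, csInf_Icc huv]

theorem envB_eq {a b : ℕ → ℤ} {k : ℕ} {u v : ℤ} (huv : u ≤ v)
    (he : envSet a b k = Set.Icc u v) : envB a b k = v := by
  rw [envB, he, csSup_Icc huv]

section Extension

variable (ι : ℤ → I) (l : ℕ) (a b : ℕ → ℤ) (x y y' : ℤ)

theorem extA_of_le {k : ℕ} (hk : k ≤ l) : extA ι l a x y y' k = a k := if_pos hk

theorem extB_of_le {k : ℕ} (hk : k ≤ l) : extB ι l b x y y' k = b k := if_pos hk

theorem extA_right {m : ℕ} (hm : 1 ≤ m) (hmp : m ≤ (y' - y).toNat) :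
    extA ι l a x y y' (l + m) = jplus ι x (ι (y + m)) := by
  rw [extA, if_neg (by omega), if_pos (by omega), Nat.add_sub_cancel_left]

theorem extB_right {m : ℕ} (hm : 1 ≤ m) (hmp : m ≤ (y' - y).toNat) :
    extB ι l b x y y' (l + m) = y + m := by
  rw [extB, if_neg (by omega), if_pos (by omega), Nat.add_sub_cancel_left]

theorem extA_left {m : ℕ} (hm : 1 ≤ m) :
    extA ι l a x y y' (l + (y' - y).toNat + m) = x - m := by
  rw [extA, if_neg (by omega), if_neg (by omega), Nat.sub_sub, Nat.add_sub_cancel_left]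

theorem extB_left {m : ℕ} (hm : 1 ≤ m) :
    extB ι l b x y y' (l + (y' - y).toNat + m) = jminus ι y' (ι (x - m)) := by
  rw [extB, if_neg (by omega), if_neg (by omega), Nat.sub_sub, Nat.add_sub_cancel_left]

theorem envSet_ext_of_le {k : ℕ} (hk : k ≤ l) :
    envSet (extA ι l a x y y') (extB ι l b x y y') k = envSet a b k :=
  envSet_congr (fun _ hj => extA_of_le ι l a x y y' (hj.trans hk))
    (fun _ hj => extB_of_le ι l b x y y' (hj.trans hk))

variable {x y}

theorem envSet_ext_right (hxy : x ≤ y) (henv : envSet a b l = Set.Icc x y)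
    {m : ℕ} (hm : m ≤ (y' - y).toNat) :
    envSet (extA ι l a x y y') (extB ι l b x y y') (l + m) = Set.Icc x (y + m) := by
  induction m with
  | zero => simpa using (envSet_ext_of_le ι l a b x y y' le_rfl).trans henv
  | succ m ih =>
    have hj := jplus_mem (ι := ι) (s := x) (t := y + (m + 1 : ℕ)) (by omega)
    rw [← add_assoc, envSet_succ, ih (by omega), add_assoc, extA_right _ _ _ _ _ _ (by omega) hm,
      extB_right _ _ _ _ _ _ (by omega) hm]
    ext z
    simp only [Set.mem_union, Set.mem_Icc]
    omega

theorem envSet_ext_left (hxy : x ≤ y) (henv : envSet a b l = Set.Icc x y)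
    (hy' : y ≤ y') (m : ℕ) :
    envSet (extA ι l a x y y') (extB ι l b x y y') (l + (y' - y).toNat + m)
      = Set.Icc (x - m) y' := by
  induction m with
  | zero =>
    rw [add_zero, envSet_ext_right ι l a b y' hxy henv le_rfl]
    congr 1 <;> omega
  | succ m ih =>
    have hj := jminus_mem (ι := ι) (s := y') (t := x - (m + 1 : ℕ)) (by omega)
    rw [← add_assoc, envSet_succ, ih, add_assoc, extA_left _ _ _ _ _ _ (by omega),
      extB_left _ _ _ _ _ _ (by omega)]
    ext z
    simp only [Set.mem_union, Set.mem_Icc]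
    omega

end Extension

theorem stmt13 (ι : ℤ → I) (hub : FibersUnbounded ι)
    (l : ℕ) (hl : 1 ≤ l) (a b : ℕ → ℤ) (h : IsAdmissibleChain ι (l : ℕ∞) a b)
    (x y x' y' : ℤ) (hx : envA a b l = x) (hy : envB a b l = y)
    (hx' : x' ≤ x) (hy' : y ≤ y') :
    IsAdmissibleChain ι (((y' - x' + 1).toNat : ℕ) : ℕ∞)
      (extA ι l a x y y') (extB ι l b x y y') ∧
    chainRange (((y' - x' + 1).toNat : ℕ) : ℕ∞) (extA ι l a x y y') (extB ι l b x y y')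
      = Set.Icc x' y' := by
  obtain ⟨-, henv, hcard, -⟩ := h l hl le_rfl
  rw [hx, hy] at henv hcard
  have hxy : x ≤ y := by omega
  refine ⟨fun k hk1 hk => ?_, ?_⟩
  · rw [Nat.cast_le] at hk
    rcases le_or_gt k l with hkl | hkl
    · have hadm := h k hk1 (Nat.cast_le.2 hkl)
      have he := envSet_ext_of_le ι l a b x y y' hkl
      simpa only [envA, envB, he, extA_of_le ι l a x y y' hkl, extB_of_le ι l b x y y' hkl]
        using hadm
    rcases le_or_gt k (l + (y' - y).toNat) with hkr | hkr
    · obtain ⟨m, rfl⟩ := Nat.exists_eq_add_of_le hkl.le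
      have he := envSet_ext_right ι l a b y' hxy henv (m := m) (by omega)
      have hj := jplus_mem (ι := ι) (s := x) (t := y + m) (by omega)
      rw [envA_eq (by omega) he, envB_eq (by omega) he, extA_right _ _ _ _ _ _ (by omega) (by omega),
        extB_right _ _ _ _ _ _ (by omega) (by omega)]
      exact ⟨hj.2, he, by push_cast; omega, Or.inr ⟨rfl, rfl⟩⟩
    · obtain ⟨m, rfl⟩ := Nat.exists_eq_add_of_le hkr.le
      have he := envSet_ext_left ι l a b y' hxy henv hy' m
      have hj := jminus_mem (ι := ι) (s := y') (t := x - m) (by omega)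
      rw [envA_eq (by omega) he, envB_eq (by omega) he, extA_left _ _ _ _ _ _ (by omega),
        extB_left _ _ _ _ _ _ (by omega)]
      exact ⟨⟨hj.2.1, hj.2.2.symm⟩, he, by omega, Or.inl ⟨rfl, rfl⟩⟩
  · have hlen : (y' - x' + 1).toNat = l + (y' - y).toNat + (x - x').toNat := by omega
    rw [chainRange_natCast, hlen, envSet_ext_left ι l a b y' hxy henv hy']
    congr 1
    omega
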